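/- Let A ⊆ Ω ⊆ ℝ^d with A Borel and Ω open, let μ be a locally finite Borel measure on ℝ^d which gives no mass to small sets, and let f : A → ℝ be measurable. Suppose f is μ-differentiable on A, i.e. there exists a countable family of functions φ_n : Ω → ℝ (n ∈ ℕ) such that for every x ∈ A there exists n with φ_n(x) = f(x) and φ_n differentiable at x. Then there exists a function g : A → ℝ^d, unique up to μ-negligible sets, with the property that for every φ : Ω → ℝ, g(x) = ∇φ(x) for μ-almost every x ∈ A such that f(x) = φ(x) and φ is differentiable at x. -/

import Mathlib

open MeasureTheory Metric Set
open scoped NNReal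

noncomputable section

/-- A `(d−1)-`rectifiable ("small") subset of `ℝ^d`: a set covered by countably many
Lipschitz images of `ℝ^{d−1}`. -/
def IsSmallSet (d : ℕ) (A : Set (EuclideanSpace ℝ (Fin d))) : Prop :=
  ∃ f : ℕ → EuclideanSpace ℝ (Fin (d - 1)) → EuclideanSpace ℝ (Fin d),
    (∀ n, ∃ K : ℝ≥0, LipschitzWith K (f n)) ∧ A ⊆ ⋃ n, Set.range (f n)

/-- `μ` gives no mass to small sets: every `(d−1)`-rectifiable set is `μ`-negligible. -/
def GivesNoMassToSmallSets {d : ℕ} (μ : Measure (EuclideanSpace ℝ (Fin d))) : Prop :=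
  ∀ A : Set (EuclideanSpace ℝ (Fin d)), IsSmallSet d A → μ A = 0

/-- A set all of whose chords make a uniformly positive angle with the line `ℝ e` lies on the graph
of a Lipschitz function over the hyperplane orthogonal to `e`. -/
theorem isSmallSet_of_abs_inner_le {d : ℕ} {e : EuclideanSpace ℝ (Fin d)} (he : e ≠ 0)
    {T : Set (EuclideanSpace ℝ (Fin d))}
    (hT : ∀ x ∈ T, ∀ y ∈ T, |inner ℝ e (y - x)| ≤ ‖e‖ / 2 * ‖y - x‖) : IsSmallSet d T := by
  obtain _ | n := d
  · exact (he (Subsingleton.elim _ _)).elim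
  have : Fact (Module.finrank ℝ (EuclideanSpace ℝ (Fin (n + 1))) = n + 1) := ⟨by simp⟩
  let b := OrthonormalBasis.fromOrthogonalSpanSingleton (𝕜 := ℝ) n he
  let L : EuclideanSpace ℝ (Fin (n + 1)) → EuclideanSpace ℝ (Fin n) :=
    fun x ↦ b.repr ((ℝ ∙ e)ᗮ.orthogonalProjectionOnto x)
  have key : ∀ x ∈ T, ∀ y ∈ T, ‖y - x‖ ≤ 2 * dist (L y) (L x) := by
    intro x hx y hy
    have he' : 0 < ‖e‖ := norm_pos_iff.2 he
    have hL : dist (L y) (L x) = ‖(ℝ ∙ e)ᗮ.starProjection (y - x)‖ := by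
      simp only [L, b.repr.dist_map, dist_eq_norm, ← map_sub, Submodule.starProjection_apply,
        Submodule.coe_norm]
    have hQ : ‖(ℝ ∙ e).starProjection (y - x)‖ ≤ ‖y - x‖ / 2 := by
      rw [Submodule.starProjection_singleton, norm_smul, norm_div]
      have := hT x hx y hy
      simp only [RCLike.ofReal_real_eq_id, id, Real.norm_eq_abs, abs_pow, abs_norm]
      calc _ ≤ ‖e‖ / 2 * ‖y - x‖ / ‖e‖ ^ 2 * ‖e‖ := by gcongr
        _ = ‖y - x‖ / 2 := by field_simp
    have hdec := norm_add_le ((ℝ ∙ e).starProjection (y - x)) ((ℝ ∙ e)ᗮ.starProjection (y - x))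
    rw [Submodule.starProjection_add_starProjection_orthogonal] at hdec
    rw [hL]
    linarith
  have hinj : InjOn L T := fun x hx y hy hxy ↦ by
    have := key x hx y hy
    rw [hxy, dist_self, mul_zero] at this
    exact (sub_eq_zero.1 (norm_le_zero_iff.1 this)).symm
  have hlip : LipschitzOnWith 2 (Function.invFunOn L T) (L '' T) := by
    refine LipschitzOnWith.of_dist_le_mul ?_
    rintro _ ⟨y, hy, rfl⟩ _ ⟨x, hx, rfl⟩
    rw [hinj.leftInvOn_invFunOn hy, hinj.leftInvOn_invFunOn hx, dist_eq_norm]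
    exact key x hx y hy
  obtain ⟨G, hG, hGeq⟩ := hlip.extend_finite_dimension
  refine ⟨fun _ ↦ G, fun _ ↦ ⟨_, hG⟩, fun x hx ↦ mem_iUnion.2 ⟨0, L x, ?_⟩⟩
  exact (hGeq (mem_image_of_mem L hx)).symm.trans (hinj.leftInvOn_invFunOn hx)

/-- At a zero with nonvanishing gradient, nearby zeros lie in a cone around the hyperplane
orthogonal to any vector close enough to the gradient. -/
theorem HasGradientAt.exists_abs_inner_le {F : Type*} [NormedAddCommGroup F]
    [InnerProductSpace ℝ F] [CompleteSpace F] {h : F → ℝ} {p e x : F} (hp : HasGradientAt h p x)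
    (hx : h x = 0) (hpe : ‖p - e‖ < ‖e‖ / 4) :
    ∃ k : ℕ, ∀ y, h y = 0 → dist y x < 1 / (k + 1 : ℝ) →
      |inner ℝ e (y - x)| ≤ ‖e‖ / 2 * ‖y - x‖ := by
  have he : 0 < ‖e‖ / 4 := (norm_nonneg _).trans_lt hpe
  have ho := (hasGradientAt_iff_isLittleO.1 hp).def he
  obtain ⟨r, hr, hball⟩ := Metric.eventually_nhds_iff.1 ho
  obtain ⟨k, hk⟩ := exists_nat_one_div_lt hr
  refine ⟨k, fun y hy hyx ↦ ?_⟩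
  have h1 := hball (hyx.trans hk)
  simp only [hy, hx, sub_zero, zero_sub, norm_neg, Real.norm_eq_abs] at h1
  have h2 := abs_real_inner_le_norm (p - e) (y - x)
  have h3 : ‖p - e‖ * ‖y - x‖ ≤ ‖e‖ / 4 * ‖y - x‖ := by gcongr
  have h4 : inner ℝ e (y - x) = inner ℝ p (y - x) - inner ℝ (p - e) (y - x) := by
    rw [inner_sub_left]; ring
  rw [h4]
  have := abs_sub (inner ℝ p (y - x)) (inner ℝ (p - e) (y - x))
  linarith

theorem GivesNoMassToSmallSets.measure_zeros_gradient_ne_zero {d : ℕ}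
    {μ : Measure (EuclideanSpace ℝ (Fin d))} (hμ : GivesNoMassToSmallSets μ)
    (h : EuclideanSpace ℝ (Fin d) → ℝ) :
    μ {x | h x = 0 ∧ ∃ p, p ≠ 0 ∧ HasGradientAt h p x} = 0 := by
  let u := TopologicalSpace.denseSeq (EuclideanSpace ℝ (Fin d))
  have hu : DenseRange u := TopologicalSpace.denseRange_denseSeq _
  let T (m k j : ℕ) : Set (EuclideanSpace ℝ (Fin d)) :=
    {x | h x = 0 ∧ u m ≠ 0 ∧ dist x (u j) < 1 / (k + 1 : ℝ) / 2 ∧ ∀ y, h y = 0 →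
      dist y x < 1 / (k + 1 : ℝ) → |inner ℝ (u m) (y - x)| ≤ ‖u m‖ / 2 * ‖y - x‖}
  have hT : ∀ m k j, μ (T m k j) = 0 := by
    intro m k j
    by_cases hm : u m = 0
    · simp [T, hm]
    · refine hμ _ (isSmallSet_of_abs_inner_le hm ?_)
      rintro x ⟨-, -, hxj, hx⟩ y ⟨hy, -, hyj, -⟩
      refine hx y hy ?_
      linarith [dist_triangle_right y x (u j)]
  refine measure_mono_null (t := ⋃ m, ⋃ k, ⋃ j, T m k j) ?_
    (measure_iUnion_null fun m ↦ measure_iUnion_null fun k ↦ measure_iUnion_null (hT m k))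
  rintro x ⟨hx, p, hp0, hp⟩
  obtain ⟨m, hm⟩ := hu.exists_dist_lt p (ε := ‖p‖ / 5) (by positivity)
  rw [dist_eq_norm] at hm
  have hpos : 0 < ‖p‖ := norm_pos_iff.2 hp0
  have htri : ‖p‖ - ‖u m‖ ≤ ‖p - u m‖ := norm_sub_norm_le _ _
  have hum : u m ≠ 0 := norm_pos_iff.1 (by linarith)
  obtain ⟨k, hk⟩ := hp.exists_abs_inner_le hx (e := u m) (by linarith)
  obtain ⟨j, hj⟩ := hu.exists_dist_lt x (ε := 1 / (k + 1 : ℝ) / 2) (by positivity)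
  simp only [mem_iUnion]
  exact ⟨m, k, j, hx, hum, hj, hk⟩

theorem GivesNoMassToSmallSets.ae_gradient_eq {d : ℕ}
    {μ : Measure (EuclideanSpace ℝ (Fin d))} (hμ : GivesNoMassToSmallSets μ)
    (φ ψ : EuclideanSpace ℝ (Fin d) → ℝ) :
    ∀ᵐ x ∂μ, φ x = ψ x → DifferentiableAt ℝ φ x → DifferentiableAt ℝ ψ x →
      gradient φ x = gradient ψ x := by
  rw [ae_iff]
  refine measure_mono_null ?_ (hμ.measure_zeros_gradient_ne_zero (φ - ψ))
  intro x hx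
  simp only [mem_ofPred_eq, Classical.not_imp] at hx
  obtain ⟨heq, hφ, hψ, hne⟩ := hx
  refine ⟨sub_eq_zero.2 heq, gradient φ x - gradient ψ x, sub_ne_zero.2 hne, ?_⟩
  rw [hasGradientAt_iff_hasFDerivAt, map_sub]
  exact hφ.hasGradientAt.hasFDerivAt.sub hψ.hasGradientAt.hasFDerivAt

/-- Let `A ⊆ Ω ⊆ ℝ^d` with `A` Borel and `Ω` open, `μ` a locally
finite Borel measure giving no mass to small sets, and `f : A → ℝ` measurable. If `f` is
`μ`-differentiable on `A` — i.e. there is a countable family `φₙ : Ω → ℝ` such that each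
`x ∈ A` satisfies `φₙ(x) = f(x)` and `φₙ` differentiable at `x` for some `n` — then there
is a `μ`-a.e. unique function `g : A → ℝ^d` such that for every `φ : Ω → ℝ`, one has
`g(x) = ∇φ(x)` at `μ`-a.e. `x ∈ A` with `f(x) = φ(x)` and `φ` differentiable at `x`. -/
theorem exists_ae_unique_mu_gradient
    {d : ℕ}
    (A Ω : Set (EuclideanSpace ℝ (Fin d))) (hAΩ : A ⊆ Ω)
    (hA : MeasurableSet A) (hΩ : IsOpen Ω)
    (μ : Measure (EuclideanSpace ℝ (Fin d))) [IsLocallyFiniteMeasure μ]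
    (hsmall : GivesNoMassToSmallSets μ)
    (f : EuclideanSpace ℝ (Fin d) → ℝ) (hf : Measurable f)
    (hdiff : ∃ φ : ℕ → EuclideanSpace ℝ (Fin d) → ℝ,
      ∀ x ∈ A, ∃ n, φ n x = f x ∧ DifferentiableAt ℝ (φ n) x) :
    ∃ g : EuclideanSpace ℝ (Fin d) → EuclideanSpace ℝ (Fin d),
      (∀ φ : EuclideanSpace ℝ (Fin d) → ℝ,
        ∀ᵐ x ∂(μ.restrict A),
          f x = φ x → DifferentiableAt ℝ φ x → g x = gradient φ x) ∧
      (∀ g' : EuclideanSpace ℝ (Fin d) → EuclideanSpace ℝ (Fin d),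
        (∀ φ : EuclideanSpace ℝ (Fin d) → ℝ,
          ∀ᵐ x ∂(μ.restrict A),
            f x = φ x → DifferentiableAt ℝ φ x → g' x = gradient φ x) →
        ∀ᵐ x ∂(μ.restrict A), g' x = g x) := by
  obtain ⟨φ, hφ⟩ := hdiff
  choose! n hn using hφ
  refine ⟨fun x ↦ gradient (φ (n x)) x, fun ψ ↦ ?_, fun g' hg' ↦ ?_⟩
  · filter_upwards [ae_restrict_mem hA,
      ae_restrict_of_ae (ae_all_iff.2 fun k ↦ hsmall.ae_gradient_eq (φ k) ψ)] with x hx hk h1 h2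
    exact hk (n x) ((hn x hx).1.trans h1) (hn x hx).2 h2
  · filter_upwards [ae_restrict_mem hA, ae_all_iff.2 fun k ↦ hg' (φ k)] with x hx hk
    exact hk (n x) (hn x hx).1.symm (hn x hx).2
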